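/- Let 𝒜 be a noetherian abelian category with a slope-like function μ as above. Then every object E of 𝒜 admits a unique filtration E₀₁ ⊆ E₀ ⊆ E₁ ⊆ ⋯ ⊆ E_m = E such that: E₀₁ lies in ℬ₀₁ = {A : C₀(A) = 0 = C₁(A)}; E₀/E₀₁ lies in ℬ₀ = {A : C₀(A) = 0} and has no nonzero subobject in ℬ₀₁; each E_i/E_{i-1} (for i ≥ 1) is μ-semistable with C₀ positive on all its nonzero subobjects; and μ(E₁/E₀) > μ(E₂/E₁) > ⋯ > μ(E_m/E_{m-1}). -/

import Mathlib

open CategoryTheory CategoryTheory.Limits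

/-- The slope `μ = C₁/C₀`, valued in `ℝ ∪ {+∞}`: it is `+∞` when `C₀ = 0`. -/
noncomputable def slopeLike (c0 : ℤ) (c1 : ℝ) : EReal :=
  if c0 = 0 then ⊤ else ((c1 / (c0 : ℝ) : ℝ) : EReal)

variable {𝒜 : Type*} [Category 𝒜] [Abelian 𝒜]

/-- The Harder–Narasimhan property for a chain of subobjects
`filt 0 ⊆ filt 1 ⊆ filt 2 ⊆ ⋯ ⊆ filt (m+1) = E`, where `filt 0` plays the role of `E₀₁`,
`filt 1` the role of `E₀`, and `filt (i+1)` the role of `E_i` for `1 ≤ i ≤ m`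
(the chain is constant equal to `⊤` from stage `m+1` on).  Writing `Q i` for the
subquotient `filt (i+1)/filt i`, the conditions are:  `filt 0 ∈ ℬ₀₁`; `Q 0 = E₀/E₀₁`
lies in `ℬ₀` and has no nonzero subobject in `ℬ₀₁`;  for `1 ≤ i ≤ m` each `Q i` is a
nonzero `μ`-semistable object all of whose nonzero subobjects have `C₀ > 0`; and the
slopes `μ(Q 1) > μ(Q 2) > ⋯ > μ(Q m)` are strictly decreasing. -/
def IsHNFiltration (c0 : 𝒜 → ℤ) (c1 : 𝒜 → ℝ) {E : 𝒜} (m : ℕ)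
    (filt : ℕ → Subobject E) : Prop :=
  ∃ hmono : Monotone filt,
    (∀ i, m + 1 ≤ i → filt i = ⊤) ∧
    (c0 ((filt 0 : Subobject E) : 𝒜) = 0 ∧ c1 ((filt 0 : Subobject E) : 𝒜) = 0) ∧
    (∀ i : ℕ, i ≤ m →
      letI Q : 𝒜 := cokernel (Subobject.ofLE (filt i) (filt (i + 1))
        (hmono (Nat.le_succ i)))
      (i = 0 → c0 Q = 0 ∧
        ∀ S : Subobject Q, S ≠ ⊥ → ¬ (c0 (S : 𝒜) = 0 ∧ c1 (S : 𝒜) = 0)) ∧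
      (1 ≤ i → ¬ IsZero Q ∧
        (∀ S : Subobject Q, S ≠ ⊥ → 0 < c0 (S : 𝒜)) ∧
        (∀ S : Subobject Q, S ≠ ⊥ →
          slopeLike (c0 (S : 𝒜)) (c1 (S : 𝒜)) ≤ slopeLike (c0 Q) (c1 Q)))) ∧
    (∀ i : ℕ, 1 ≤ i → i + 1 ≤ m →
      slopeLike
          (c0 (cokernel (Subobject.ofLE (filt (i + 1)) (filt (i + 2))
            (hmono (Nat.le_succ (i + 1))))))
          (c1 (cokernel (Subobject.ofLE (filt (i + 1)) (filt (i + 2))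
            (hmono (Nat.le_succ (i + 1)))))) <
        slopeLike
          (c0 (cokernel (Subobject.ofLE (filt i) (filt (i + 1))
            (hmono (Nat.le_succ i)))))
          (c1 (cokernel (Subobject.ofLE (filt i) (filt (i + 1))
            (hmono (Nat.le_succ i))))))

namespace HNLat

structure Data (L : Type*) [Lattice L] (r : L → ℤ) (d : L → ℝ) : Prop where
  rmono : ∀ {a b : L}, a ≤ b → r a ≤ r b
  dmono : ∀ {a b : L}, a ≤ b → r a = r b → d a ≤ d b
  rmod : ∀ a b : L, r (a ⊔ b) + r (a ⊓ b) = r a + r b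
  dmod : ∀ a b : L, d (a ⊔ b) + d (a ⊓ b) = d a + d b

variable {L : Type*} [Lattice L] {r : L → ℤ} {d : L → ℝ}

/-- twisted degree -/
def phi (r : L → ℤ) (d : L → ℝ) (l : ℝ) (x : L) : ℝ := d x - l * r x

theorem phi_mod (D : Data L r d) (l : ℝ) (a b : L) :
    phi r d l (a ⊔ b) + phi r d l (a ⊓ b) = phi r d l a + phi r d l b := by
  have h1 : ((r (a ⊔ b) : ℝ)) + r (a ⊓ b) = r a + r b := by exact_mod_cast D.rmod a b
  have h2 := D.dmod a b
  unfold phi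
  linear_combination h2 - l * h1

theorem exists_max_phi [WellFoundedGT L] (D : Data L r d) (l : ℝ) (A : L) :
    ∃ M, A ≤ M ∧ ∀ X, A ≤ X → phi r d l X ≤ phi r d l M := by
  let dom : Set L := {X | A ≤ X ∧ ∀ Y, A ≤ Y → Y ≤ X → phi r d l Y ≤ phi r d l X}
  have hA : A ∈ dom := ⟨le_rfl, fun Y h1 h2 => by rw [le_antisymm h1 h2]⟩
  have up : ∀ X ∈ dom, ∀ Z, A ≤ Z → phi r d l Z ≤ phi r d l (Z ⊔ X) := by
    intro X hX Z hZ
    have := phi_mod D l Z X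
    have := hX.2 (Z ⊓ X) (le_inf hZ hX.1) inf_le_right
    linarith
  have hsup : ∀ X ∈ dom, ∀ Y ∈ dom, X ⊔ Y ∈ dom := by
    intro X hX Y hY
    refine ⟨hX.1.trans le_sup_left, fun Z hAZ hZ => ?_⟩
    have h1 := up X hX Z hAZ
    have h2 := up Y hY (Z ⊔ X) (hAZ.trans le_sup_left)
    have : Z ⊔ X ⊔ Y = X ⊔ Y := by rw [sup_assoc]; exact sup_eq_right.2 hZ
    rw [this] at h2
    exact h1.trans h2
  obtain ⟨M, hM, hmax⟩ := WellFounded.has_min (wellFounded_gt (α := L)) dom ⟨A, hA⟩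
  have hgr : ∀ Y ∈ dom, Y ≤ M := by
    intro Y hY
    by_contra hn
    exact hmax _ (hsup M hM Y hY) (left_lt_sup.2 hn)
  refine ⟨M, hM.1, ?_⟩
  have key : ∀ n : ℕ, ∀ Z, A ≤ Z → (r Z - r A).toNat = n → phi r d l Z ≤ phi r d l M := by
    intro n
    induction n using Nat.strong_induction_on with
    | _ n ih =>
      intro Z hZ hn
      by_cases hd : Z ∈ dom
      · exact hM.2 Z hZ (hgr Z hd)
      · have : ∃ Y, A ≤ Y ∧ Y ≤ Z ∧ phi r d l Z < phi r d l Y := by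
          by_contra! hc
          exact hd ⟨hZ, hc⟩
        obtain ⟨Y, hAY, hYZ, hlt⟩ := this
        have hr := D.rmono hYZ
        have hr0 := D.rmono hAY
        have hne : r Y ≠ r Z := by
          intro he
          have := D.dmono hYZ he
          unfold phi at hlt
          rw [he] at hlt
          linarith
        exact hlt.le.trans (ih (r Y - r A).toNat (by omega) Y hAY rfl)
  exact fun X hX => key _ X hX rfl

/-- saturated -/
def Sat (r : L → ℤ) (A : L) : Prop := ∀ X, A < X → r A < r X

theorem exists_max_slope_aux [WellFoundedGT L] (D : Data L r d) (A : L) (hS : Sat r A) :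
    ∀ n : ℕ, ∀ X l, A < X → (r X - r A).toNat = n → 
      (∀ Y, A ≤ Y → phi r d l Y ≤ phi r d l X) →
      ∃ Z l, A < Z ∧ phi r d l Z = phi r d l A ∧ ∀ Y, A ≤ Y → phi r d l Y ≤ phi r d l A := by
  intro n
  induction n using Nat.strong_induction_on with
  | _ n ih =>
    intro X l hX hn hmax
    have hr := hS X hX
    have hr' : (0:ℝ) < r X - r A := by rw [sub_pos]; exact_mod_cast hr
    set l' : ℝ := (d X - d A) / (r X - r A) with hl'
    have hl'' : d X - d A = l' * (r X - r A) := by rw [hl']; field_simp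
    have hXA : phi r d l' X = phi r d l' A := by unfold phi; linarith
    obtain ⟨Y, hY, hYm⟩ := exists_max_phi D l' A
    by_cases hc : phi r d l' Y ≤ phi r d l' A
    · exact ⟨X, l', hX, hXA, fun Z hZ => (hYm Z hZ).trans hc⟩
    · push Not at hc
      have hAY : A < Y := lt_of_le_of_ne hY (by rintro rfl; exact lt_irrefl _ hc)
      have h1 := hmax Y hY
      have h2 := hmax A le_rfl
      have h3 := hS Y hAY
      refine ih _ ?_ Y l' hAY rfl hYm
      have hll : l ≤ l' := by
        unfold phi at h2
        by_contra! hcon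
        nlinarith
      have : r Y < r X := by
        by_contra! hcon
        have hcon' : (r X : ℝ) ≤ r Y := by exact_mod_cast hcon
        unfold phi at *
        nlinarith
      omega

theorem exists_step [WellFoundedGT L] [OrderTop L] (D : Data L r d) (A : L) (hS : Sat r A)
    (hA : A ≠ ⊤) :
    ∃ B l, A < B ∧ phi r d l B = phi r d l A ∧ (∀ Y, A ≤ Y → phi r d l Y ≤ phi r d l A) ∧
      (∀ Y, B < Y → phi r d l Y < phi r d l B) ∧ Sat r B := by
  have hT : A < ⊤ := lt_top_iff_ne_top.2 hA
  have hr := hS _ hT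
  have hr' : (0:ℝ) < r ⊤ - r A := by rw [sub_pos]; exact_mod_cast hr
  obtain ⟨Z, l, hZ, hZe, hl⟩ : ∃ Z l, A < Z ∧ phi r d l Z = phi r d l A ∧
      ∀ Y, A ≤ Y → phi r d l Y ≤ phi r d l A := by
    set l' : ℝ := (d ⊤ - d A) / (r ⊤ - r A) with hl'
    have hl'' : d ⊤ - d A = l' * (r ⊤ - r A) := by rw [hl']; field_simp
    have hXA : phi r d l' ⊤ = phi r d l' A := by unfold phi; linarith
    obtain ⟨Y, hY, hYm⟩ := exists_max_phi D l' A
    by_cases hc : phi r d l' Y ≤ phi r d l' A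
    · exact ⟨⊤, l', hT, hXA, fun Z hZ => (hYm Z hZ).trans hc⟩
    · push Not at hc
      have hAY : A < Y := lt_of_le_of_ne hY (by rintro rfl; exact lt_irrefl _ hc)
      exact exists_max_slope_aux D A hS _ Y l' hAY rfl hYm
  obtain ⟨B, ⟨hB, hBe⟩, hmax⟩ := WellFounded.has_min (wellFounded_gt (α := L))
    {X | A < X ∧ phi r d l X = phi r d l A} ⟨Z, hZ, hZe⟩
  have h4 : ∀ Y, B < Y → phi r d l Y < phi r d l B := by
    intro Y hY
    rw [hBe]
    refine lt_of_le_of_ne (hl Y (hB.trans hY).le) fun he => hmax Y ⟨hB.trans hY, he⟩ hY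
  refine ⟨B, l, hB, hBe, hl, h4, fun X hX => ?_⟩
  refine lt_of_le_of_ne (D.rmono hX.le) fun he => ?_
  have h5 := h4 X hX
  have := D.dmono hX.le he
  unfold phi at h5
  rw [he] at h5
  linarith

/-- HN chain condition from `A` -/
structure Chain [OrderTop L] (r : L → ℤ) (d : L → ℝ) (m : ℕ) (f : ℕ → L) (l : ℕ → ℝ) :
    Prop where
  mono : Monotone f
  top : ∀ i, m ≤ i → f i = ⊤
  lt : ∀ i, i < m → f i < f (i + 1)
  pos : ∀ i, i < m → ∀ X, f i < X → X ≤ f (i + 1) → r (f i) < r X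
  eq : ∀ i, i < m → phi r d (l i) (f (i + 1)) = phi r d (l i) (f i)
  le : ∀ i, i < m → ∀ X, f i < X → X ≤ f (i + 1) → phi r d (l i) X ≤ phi r d (l i) (f i)
  anti : ∀ i, i + 1 < m → l (i + 1) < l i

theorem exists_chain [WellFoundedGT L] [OrderTop L] (D : Data L r d) (A : L) :
    Sat r A → ∃ m f l, f 0 = A ∧ Chain r d m f l := by
  induction A using WellFoundedGT.induction with
  | ind A ih =>
    intro hS
    by_cases hA : A = ⊤
    · subst hA
      refine ⟨0, fun _ => ⊤, fun _ => 0, rfl, ?_⟩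
      constructor <;> simp [monotone_const]
    · obtain ⟨B, l, hAB, hBe, hle, hlt, hB⟩ := exists_step D A hS hA
      obtain ⟨m, f, k, hf0, hC⟩ := ih B hAB hB
      refine ⟨m + 1, fun i => Nat.casesOn i A f, fun i => Nat.casesOn i l k, rfl, ?_⟩
      constructor
      · refine monotone_nat_of_le_succ fun i => ?_
        cases i with
        | zero => simpa [hf0] using hAB.le
        | succ i => exact hC.mono (Nat.le_succ i)
      · intro i hi
        cases i with
        | zero => omega
        | succ i => exact hC.top i (by omega)
      · intro i hi
        cases i with
        | zero => simpa [hf0] using hAB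
        | succ i => exact hC.lt i (by omega)
      · intro i hi
        cases i with
        | zero => exact fun X hX _ => hS X hX
        | succ i => exact hC.pos i (by omega)
      · intro i hi
        cases i with
        | zero => simpa [hf0] using hBe
        | succ i => exact hC.eq i (by omega)
      · intro i hi
        cases i with
        | zero => exact fun X hX _ => hle X hX.le
        | succ i => exact hC.le i (by omega)
      · intro i hi
        cases i with
        | zero =>
          have h1 := hC.lt 0 (by omega)
          have h2 := hC.eq 0 (by omega)
          have h4 := hC.pos 0 (by omega) _ h1 le_rfl
          rw [hf0] at h1 h2 h4
          have h3 := hlt _ h1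
          have h4' : ((r B : ℝ)) < r (f (0+1)) := by exact_mod_cast h4
          change k 0 < l
          by_contra! hcon
          unfold phi at *
          nlinarith
        | succ i => exact hC.anti i (by omega)

theorem Chain.anti_le [OrderTop L] {m : ℕ} {f : ℕ → L} {l : ℕ → ℝ} (C : Chain r d m f l)
    (i j : ℕ) (hij : i < j) (hj : j < m) : l j < l i := by
  induction j with
  | zero => omega
  | succ j ih =>
    have := C.anti j hj
    rcases Nat.lt_succ_iff_lt_or_eq.1 hij with h | h
    · exact this.trans (ih h (by omega))
    · rw [h]; exact this

theorem Chain.bound_aux [OrderTop L] (D : Data L r d) {m : ℕ} {f : ℕ → L} {l : ℕ → ℝ}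
    (C : Chain r d m f l) (i : ℕ) (hi : i < m) (X : L) (hX : f i ≤ X) (j : ℕ) 
    (hj : i + 1 ≤ j) (hjm : j ≤ m) :
    phi r d (l i) (X ⊓ f j) ≤ phi r d (l i) (f i) ∧
      (X ⊓ f j ≤ f (i + 1) ∨ phi r d (l i) (X ⊓ f j) < phi r d (l i) (f i)) := by
  induction j, hj using Nat.le_induction with
  | base =>
    refine ⟨?_, Or.inl inf_le_right⟩
    rcases (le_inf hX (C.mono (Nat.le_succ i))).eq_or_lt with h | h
    · exact (congrArg _ h.symm).le
    · exact C.le i hi _ h inf_le_right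
  | succ j hj ih =>
    obtain ⟨ih1, ih2⟩ := ih (by omega)
    have hm := phi_mod D (l i) (X ⊓ f (j + 1)) (f j)
    have e : X ⊓ f (j + 1) ⊓ f j = X ⊓ f j := by
      rw [inf_assoc, inf_eq_right.2 (C.mono (Nat.le_succ j))]
    rw [e] at hm
    rcases (le_sup_right : f j ≤ X ⊓ f (j + 1) ⊔ f j).eq_or_lt with h | h
    · have h' : X ⊓ f (j + 1) ≤ f j := by rw [h]; exact le_sup_left
      have e2 : X ⊓ f (j + 1) = X ⊓ f j :=
        le_antisymm (le_inf inf_le_left h') (inf_le_inf_left _ (C.mono (Nat.le_succ j)))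
      rw [e2]; exact ⟨ih1, ih2⟩
    · have hle : X ⊓ f (j + 1) ⊔ f j ≤ f (j + 1) :=
        sup_le inf_le_right (C.mono (Nat.le_succ j))
      have h1 := C.le j (by omega) _ h hle
      have h2 := C.pos j (by omega) _ h hle
      have h3 := C.anti_le i j (by omega) (by omega)
      have h2' : ((r (f j) : ℝ)) < r (X ⊓ f (j + 1) ⊔ f j) := by exact_mod_cast h2
      have : phi r d (l i) (X ⊓ f (j + 1) ⊔ f j) < phi r d (l i) (f j) := by
        unfold phi at h1 ⊢
        nlinarith
      constructor
      · linarith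
      · right; linarith

theorem Chain.bound [OrderTop L] (D : Data L r d) {m : ℕ} {f : ℕ → L} {l : ℕ → ℝ}
    (C : Chain r d m f l) (i : ℕ) (hi : i < m) (X : L) (hX : f i ≤ X) :
    phi r d (l i) X ≤ phi r d (l i) (f i) ∧
      (X ≤ f (i + 1) ∨ phi r d (l i) X < phi r d (l i) (f i)) := by
  have := C.bound_aux D i hi X hX m hi le_rfl
  rwa [C.top m le_rfl, inf_top_eq] at this

theorem Chain.step_le [OrderTop L] (D : Data L r d) {m m' : ℕ} {f f' : ℕ → L} {l l' : ℕ → ℝ}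
    (C : Chain r d m f l) (C' : Chain r d m' f' l') (i : ℕ) (h : f i = f' i)
    (hi : i < m) (hi' : i < m') :
    l' i ≤ l i ∧ (l' i = l i → f' (i + 1) ≤ f (i + 1)) := by
  have hlt := C'.lt i hi'
  have h1 := C.bound D i hi (f' (i + 1)) (h ▸ hlt.le)
  have h2 := C'.eq i hi'
  have h3 := C'.pos i hi' _ hlt le_rfl
  have h3' : ((r (f' i) : ℝ)) < r (f' (i + 1)) := by exact_mod_cast h3
  rw [h] at h1
  constructor
  · by_contra! hcon
    have h1 := h1.1
    unfold phi at *
    nlinarith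
  · intro he
    rw [he] at h2
    exact h1.2.resolve_right (by rw [h2]; exact lt_irrefl _)

theorem Chain.unique [OrderTop L] (D : Data L r d) {m m' : ℕ} {f f' : ℕ → L} {l l' : ℕ → ℝ}
    (C : Chain r d m f l) (C' : Chain r d m' f' l') (h0 : f 0 = f' 0) : m = m' ∧ f = f' := by
  have key : ∀ i, f i = f' i := by
    intro i
    induction i with
    | zero => exact h0
    | succ i ih =>
      by_cases hi : i < m
      · by_cases hi' : i < m'
        · have h1 := C.step_le D C' i ih hi hi'
          have h2 := C'.step_le D C i ih.symm hi' hi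
          have he := le_antisymm h1.1 h2.1
          exact le_antisymm (h2.2 he.symm) (h1.2 he)
        · have := C.lt i hi
          rw [ih, C'.top i (by omega)] at this
          exact absurd this not_top_lt
      · by_cases hi' : i < m'
        · have := C'.lt i hi'
          rw [← ih, C.top i (by omega)] at this
          exact absurd this not_top_lt
        · rw [C.top _ (by omega), C'.top _ (by omega)]
  refine ⟨?_, funext key⟩
  rcases lt_trichotomy m m' with h | h | h
  · have := C'.lt m h
    rw [← key, C.top m le_rfl] at this
    exact absurd this not_top_lt
  · exact h
  · have := C.lt m' h
    rw [key, C'.top m' le_rfl] at this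
    exact absurd this not_top_lt

/-- full HN -/
structure HN [BoundedOrder L] (r : L → ℤ) (d : L → ℝ) (m : ℕ) (f : ℕ → L) : Prop where
  mono : Monotone f
  r0 : r (f 0) = 0
  d0 : d (f 0) = 0
  r1 : r (f 1) = 0
  tf : ∀ X, f 0 < X → X ≤ f 1 → ¬ (r X = 0 ∧ d X = 0)
  chain : ∃ l, Chain r d m (fun i => f (i + 1)) l

theorem HN.le1 [BoundedOrder L] (D : Data L r d) (hb : r ⊥ = 0) {m : ℕ}
    {f : ℕ → L} (H : HN r d m f) (X : L) (hX : r X = 0) : X ≤ f 1 := by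
  obtain ⟨l, C⟩ := H.chain
  have : ∀ k, k ≤ m → X ≤ f (m - k + 1) := by
    intro k
    induction k with
    | zero => intro _; exact le_top.trans (C.top m le_rfl).ge
    | succ k ih =>
      intro hk
      have h1 := ih (by omega)
      obtain ⟨j, hj⟩ : ∃ j, m - k = j + 1 := ⟨m - k - 1, by omega⟩
      have hj' : m - (k + 1) = j := by omega
      rw [hj] at h1
      rw [hj']
      by_contra hn
      have h2 := C.pos j (by omega) (X ⊔ f (j + 1)) (right_lt_sup.2 hn)
        (sup_le h1 (H.mono (Nat.le_succ _)))
      have h3 := D.rmod X (f (j + 1))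
      have h4 := D.rmono (bot_le : ⊥ ≤ X ⊓ f (j + 1))
      omega
  simpa using this m le_rfl

theorem HN.le0 [BoundedOrder L] (D : Data L r d) (hb : r ⊥ = 0) (hbd : d ⊥ = 0) {m : ℕ}
    {f : ℕ → L} (H : HN r d m f) (X : L) (hX : r X = 0) (hXd : d X = 0) : X ≤ f 0 := by
  have h1 := H.le1 D hb X hX
  by_contra hn
  have h3 := D.rmod X (f 0)
  have h3' := D.dmod X (f 0)
  have h4 := D.rmono (bot_le : ⊥ ≤ X ⊓ f 0)
  have h5 := D.rmono (bot_le : ⊥ ≤ X ⊔ f 0)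
  have e0 := H.r0
  have d0 := H.d0
  have h6 := D.dmono (bot_le : ⊥ ≤ X ⊓ f 0) (by omega)
  have h7 := D.dmono (bot_le : ⊥ ≤ X ⊔ f 0) (by omega)
  refine H.tf (X ⊔ f 0) (right_lt_sup.2 hn) (sup_le h1 (H.mono zero_le_one)) ⟨by omega, ?_⟩
  linarith

theorem HN.unique [BoundedOrder L] (D : Data L r d) (hb : r ⊥ = 0) (hbd : d ⊥ = 0) {m m' : ℕ}
    {f f' : ℕ → L} (H : HN r d m f) (H' : HN r d m' f') : m' = m ∧ f' = f := by
  obtain ⟨l, C⟩ := H.chain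
  obtain ⟨l', C'⟩ := H'.chain
  have e0 : f 0 = f' 0 :=
    le_antisymm (H'.le0 D hb hbd _ H.r0 H.d0) (H.le0 D hb hbd _ H'.r0 H'.d0)
  have e1 : f 1 = f' 1 :=
    le_antisymm (H'.le1 D hb _ H.r1) (H.le1 D hb _ H'.r1)
  have := C.unique D C' e1
  refine ⟨this.1.symm, funext fun i => ?_⟩
  cases i with
  | zero => exact e0.symm
  | succ i => exact (congrFun this.2 i).symm

theorem HN.exist [WellFoundedGT L] [BoundedOrder L] (D : Data L r d) (hb : r ⊥ = 0)
    (hbd : d ⊥ = 0) : ∃ m f, HN r d m f := by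
  obtain ⟨A, hA, hAm⟩ := WellFounded.has_min (wellFounded_gt (α := L))
    {X | r X = 0} ⟨⊥, hb⟩
  obtain ⟨B, ⟨hBA, hB, hBd⟩, hBm⟩ := WellFounded.has_min (wellFounded_gt (α := L))
    {X | X ≤ A ∧ r X = 0 ∧ d X = 0} ⟨⊥, bot_le, hb, hbd⟩
  have hS : Sat r A := by
    intro X hX
    refine lt_of_le_of_ne (D.rmono hX.le) fun he => hAm X ?_ hX
    change r X = 0
    rw [← he]; exact hA
  obtain ⟨m, f, l, hf, C⟩ := exists_chain D A hS
  refine ⟨m, fun i => Nat.casesOn i B f, ?_, hB, hBd, by simpa [hf] using hA, ?_, l, C⟩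
  · refine monotone_nat_of_le_succ fun i => ?_
    cases i with
    | zero => simpa [hf] using hBA
    | succ i => exact C.mono (Nat.le_succ i)
  · intro X h1 h2 h3
    have h2' : X ≤ f 0 := h2
    rw [hf] at h2'
    exact hBm X ⟨h2', h3⟩ h1

end HNLat

namespace HNCat

/-- additive function -/
structure Addi {G : Type*} [AddCommGroup G] (c : 𝒜 → G) : Prop where
  add : ∀ {A B : 𝒜} (f : A ⟶ B), Mono f → c B = c A + c (cokernel f)
  zero : ∀ {A : 𝒜}, IsZero A → c A = 0

theorem zero_of_nonneg {G : Type*} [AddCommGroup G] [PartialOrder G] [IsOrderedAddMonoid G]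
    (c : 𝒜 → G) (add : ∀ {A B : 𝒜} (f : A ⟶ B), Mono f → c B = c A + c (cokernel f))
    (hn : ∀ A, IsZero A → 0 ≤ c A) {A : 𝒜} (hA : IsZero A) : c A = 0 := by
  have key : ∀ {A B : 𝒜}, IsZero A → IsZero B → c A ≤ c B := by
    intro A B hA hB
    have hm : Mono (0 : A ⟶ B) := ⟨fun _ _ _ => hA.eq_of_tgt _ _⟩
    have he : Epi (0 : A ⟶ B) := ⟨fun _ _ _ => hB.eq_of_src _ _⟩
    rw [add (0 : A ⟶ B) hm]
    exact le_add_of_nonneg_right (hn _ (isZero_cokernel_of_epi _))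
  have h1 : IsZero (cokernel (𝟙 A)) := isZero_cokernel_of_epi _
  have h2 : c (cokernel (𝟙 A)) = 0 := by
    have := add (𝟙 A) inferInstance
    simpa using this
  rw [← h2]
  exact le_antisymm (key hA h1) (key h1 hA)

variable {G : Type*} [AddCommGroup G] {c : 𝒜 → G}

theorem Addi.iso (h : Addi c) {A B : 𝒜} (f : A ≅ B) : c A = c B := by
  rw [h.add f.hom inferInstance, h.zero (isZero_cokernel_of_epi f.hom), add_zero]

theorem Addi.epi (h : Addi c) {A B : 𝒜} (p : A ⟶ B) [Epi p] : c A = c (kernel p) + c B := by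
  rw [h.add (kernel.ι p) inferInstance]
  congr 1
  exact h.iso ((colimit.isColimit _).coconePointUniqueUpToIso
    (Abelian.epiIsCokernelOfKernel _ (limit.isLimit (parallelPair p 0))))

theorem Addi.subMk (h : Addi c) {A E : 𝒜} (f : A ⟶ E) [Mono f] :
    c (Subobject.mk f : 𝒜) = c A := h.iso (Subobject.underlyingIso f)

theorem Addi.coker (h : Addi c) {E : 𝒜} {A B : Subobject E} (hAB : A ≤ B) :
    c (cokernel (Subobject.ofLE A B hAB)) = c (B : 𝒜) - c (A : 𝒜) := by
  rw [h.add (Subobject.ofLE A B hAB) inferInstance, add_sub_cancel_left]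

theorem le_of_comp_zero {E : 𝒜} {A B : Subobject E} (hAB : A ≤ B) {X : 𝒜} (g : X ⟶ B)
    [Mono g] (hg : g ≫ cokernel.π (Subobject.ofLE A B hAB) = 0) :
    Subobject.mk (g ≫ B.arrow) ≤ A := by
  refine Subobject.mk_le_of_comm (Abelian.monoLift (Subobject.ofLE A B hAB) g hg) ?_
  have := Abelian.monoLift_comp (Subobject.ofLE A B hAB) g hg
  rw [← Subobject.ofLE_arrow hAB, ← Category.assoc, this]

theorem le_mk_kernel {E : 𝒜} {A B : Subobject E} (hAB : A ≤ B) {Y : 𝒜} (p : (B : 𝒜) ⟶ Y)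
    (hp : Subobject.ofLE A B hAB ≫ p = 0) :
    A ≤ Subobject.mk (kernel.ι p ≫ B.arrow) := by
  refine Subobject.le_mk_of_comm (kernel.lift p (Subobject.ofLE A B hAB) hp) ?_
  simp

theorem mk_le_self {E : 𝒜} {B : Subobject E} {X : 𝒜} (g : X ⟶ B) [Mono g] :
    Subobject.mk (g ≫ B.arrow) ≤ B := Subobject.mk_le_of_comm g rfl

theorem zero_of_le_mk_kernel {E : 𝒜} {B : Subobject E} {Y : 𝒜} (p : (B : 𝒜) ⟶ Y)
    (h : B ≤ Subobject.mk (kernel.ι p ≫ B.arrow)) : p = 0 := by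
  have e : Subobject.ofLEMk B (kernel.ι p ≫ B.arrow) h ≫ kernel.ι p = 𝟙 _ := by
    rw [← cancel_mono B.arrow, Category.assoc, Subobject.ofLEMk_comp, Category.id_comp]
  rw [← Category.id_comp p, ← e, Category.assoc, kernel.condition, comp_zero]

theorem Addi.modular (h : Addi c) {E : 𝒜} (A B : Subobject E) :
    c ((A ⊔ B : Subobject E) : 𝒜) + c ((A ⊓ B : Subobject E) : 𝒜) = c (A : 𝒜) + c (B : 𝒜) := by
  have hA : A ≤ A ⊔ B := le_sup_left
  have hB : B ≤ A ⊔ B := le_sup_right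
  let q := cokernel.π (Subobject.ofLE B (A ⊔ B) hB)
  let p : (A : 𝒜) ⟶ cokernel (Subobject.ofLE B (A ⊔ B) hB) := Subobject.ofLE A (A ⊔ B) hA ≫ q
  have hp : Epi p := by
    refine Preadditive.epi_of_cancel_zero _ fun t ht => ?_
    have h1 : q ≫ t = 0 := by
      refine zero_of_le_mk_kernel _ (sup_le (le_mk_kernel hA _ ?_) (le_mk_kernel hB _ ?_))
      · rw [← Category.assoc]; exact ht
      · rw [← Category.assoc, cokernel.condition, zero_comp]
    exact (cancel_epi q).1 (by rw [h1, comp_zero])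
  have hK : Subobject.mk (kernel.ι p ≫ A.arrow) = A ⊓ B := by
    refine le_antisymm (le_inf (mk_le_self _) ?_) ?_
    · have := le_of_comp_zero hB (kernel.ι p ≫ Subobject.ofLE A (A ⊔ B) hA)
        (by rw [Category.assoc]; exact kernel.condition p)
      simpa using this
    · refine le_mk_kernel inf_le_left p ?_
      have : Subobject.ofLE (A ⊓ B) A inf_le_left ≫ Subobject.ofLE A (A ⊔ B) hA =
        Subobject.ofLE (A ⊓ B) B inf_le_right ≫ Subobject.ofLE B (A ⊔ B) hB := by simp
      rw [← Category.assoc, this, Category.assoc, cokernel.condition, comp_zero]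
  have e1 := h.epi p
  rw [h.coker hB, ← h.subMk (kernel.ι p ≫ A.arrow), hK] at e1
  rw [e1]; abel

theorem to_sub {E : 𝒜} {A X B : Subobject E} (hAX : A < X) (hXB : X ≤ B) :
    ∃ S : Subobject (cokernel (Subobject.ofLE A B (hAX.le.trans hXB))), S ≠ ⊥ ∧
      ∀ {G : Type} [AddCommGroup G] (c : 𝒜 → G), Addi c → c (S : 𝒜) = c (X : 𝒜) - c (A : 𝒜) := by
  have hAB := hAX.le.trans hXB
  let p : cokernel (Subobject.ofLE A B hAB) ⟶ cokernel (Subobject.ofLE X B hXB) :=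
    cokernel.desc _ (cokernel.π _) (by
      rw [← Subobject.ofLE_comp_ofLE A X B hAX.le hXB, Category.assoc, cokernel.condition,
        comp_zero])
  have hpi : cokernel.π (Subobject.ofLE A B hAB) ≫ p = cokernel.π (Subobject.ofLE X B hXB) :=
    cokernel.π_desc _ _ _
  have hp : Epi p := by
    have : Epi (cokernel.π (Subobject.ofLE A B hAB) ≫ p) := by rw [hpi]; infer_instance
    exact epi_of_epi (cokernel.π (Subobject.ofLE A B hAB)) p
  refine ⟨Subobject.mk (kernel.ι p), ?_, ?_⟩
  · intro hbot
    rw [Subobject.mk_eq_bot_iff_zero] at hbot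
    have hm : Mono p := Preadditive.mono_of_kernel_zero hbot
    have hz : Subobject.ofLE X B hXB ≫ cokernel.π (Subobject.ofLE A B hAB) = 0 := by
      rw [← cancel_mono p, Category.assoc, hpi, cokernel.condition, zero_comp]
    have := le_of_comp_zero hAB _ hz
    simp only [Subobject.ofLE_arrow, Subobject.mk_arrow] at this
    exact not_le_of_gt hAX this
  · intro G _ c h
    have := h.epi p
    rw [h.coker, h.coker] at this
    rw [h.subMk, eq_sub_of_add_eq this.symm]
    abel

theorem of_sub {E : 𝒜} {A B : Subobject E} (hAB : A ≤ B)
    (S : Subobject (cokernel (Subobject.ofLE A B hAB))) (hS : S ≠ ⊥) :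
    ∃ X, A < X ∧ X ≤ B ∧
      ∀ {G : Type} [AddCommGroup G] (c : 𝒜 → G), Addi c → c (S : 𝒜) = c (X : 𝒜) - c (A : 𝒜) := by
  let q := cokernel.π (Subobject.ofLE A B hAB)
  let p := q ≫ cokernel.π S.arrow
  refine ⟨Subobject.mk (kernel.ι p ≫ B.arrow), ?_, mk_le_self _, ?_⟩
  · refine lt_of_le_not_ge (le_mk_kernel hAB _ ?_) fun hle => hS ?_
    · rw [← Category.assoc, cokernel.condition, zero_comp]
    · have hz : kernel.ι p ≫ q = 0 := by
        have e : Subobject.ofMkLE _ A hle ≫ Subobject.ofLE A B hAB = kernel.ι p := by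
          rw [← cancel_mono B.arrow]; simp
        rw [← e, Category.assoc, cokernel.condition, comp_zero]
      have ht : p ≫ Abelian.epiDesc p q hz = q := Abelian.comp_epiDesc p q hz
      have ht' : cokernel.π S.arrow ≫ Abelian.epiDesc p q hz = 𝟙 _ := by
        rw [← cancel_epi q, ← Category.assoc]
        exact ht.trans (Category.comp_id _).symm
      have : S.arrow = 0 := by
        rw [← Category.comp_id S.arrow, ← ht', ← Category.assoc, cokernel.condition, zero_comp]
      rw [← Subobject.mk_arrow S, Subobject.mk_eq_bot_iff_zero]
      exact this
  · intro G _ c h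
    have e1 := h.epi p
    have e2 := h.add S.arrow inferInstance
    rw [h.coker] at e2
    rw [h.subMk, eq_sub_of_add_eq e1.symm, sub_right_comm, e2]
    abel

theorem isZero_coker {E : 𝒜} {A B : Subobject E} (hAB : A ≤ B) :
    IsZero (cokernel (Subobject.ofLE A B hAB)) ↔ A = B := by
  constructor
  · intro h
    refine le_antisymm hAB ?_
    have := le_of_comp_zero hAB (𝟙 _) (h.eq_of_tgt _ _)
    simpa using this
  · rintro rfl
    have : Epi (Subobject.ofLE A A hAB) := by rw [Subobject.ofLE_refl]; infer_instance
    exact isZero_cokernel_of_epi _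

end HNCat

namespace HNBridge
open HNLat HNCat

theorem slope_pos {a : ℤ} (h : 0 < a) (b : ℝ) : slopeLike a b = ((b / (a : ℝ) : ℝ) : EReal) := by
  unfold slopeLike
  rw [if_neg h.ne']

theorem div_le_phi {L : Type*} [Lattice L] {r : L → ℤ} {d : L → ℝ} {A X : L} (h : r A < r X)
    (l : ℝ) : (d X - d A) / ((r X - r A : ℤ) : ℝ) ≤ l ↔ phi r d l X ≤ phi r d l A := by
  have : (0 : ℝ) < ((r X - r A : ℤ) : ℝ) := by exact_mod_cast sub_pos.2 h
  rw [div_le_iff₀ this]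
  unfold phi
  push_cast
  constructor <;> intro h <;> linarith

theorem div_eq_phi {L : Type*} [Lattice L] {r : L → ℤ} {d : L → ℝ} {A X : L} (h : r A < r X)
    (l : ℝ) : (d X - d A) / ((r X - r A : ℤ) : ℝ) = l ↔ phi r d l X = phi r d l A := by
  have : (0 : ℝ) < ((r X - r A : ℤ) : ℝ) := by exact_mod_cast sub_pos.2 h
  rw [div_eq_iff this.ne']
  unfold phi
  push_cast
  constructor <;> intro h <;> linarith

theorem forward {c0 : 𝒜 → ℤ} {c1 : 𝒜 → ℝ} (h0 : Addi c0) (h1 : Addi c1) {E : 𝒜} {m : ℕ}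
    {f : ℕ → Subobject E} (H : IsHNFiltration c0 c1 m f) :
    HN (fun X : Subobject E => c0 (X : 𝒜)) (fun X : Subobject E => c1 (X : 𝒜)) m f := by
  obtain ⟨hmono, htop, ⟨hr0, hd0⟩, hQ, hdec⟩ := H
  have hQ0 := (hQ 0 (Nat.zero_le m)).1 rfl
  have hlt : ∀ i, i < m → f (i + 1) < f (i + 1 + 1) := fun i hi =>
    lt_of_le_of_ne (hmono (Nat.le_succ _)) fun he =>
      ((hQ (i + 1) hi).2 (by omega)).1 ((isZero_coker _).2 he)
  have hpos : ∀ i, i < m → ∀ X, f (i + 1) < X → X ≤ f (i + 1 + 1) →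
      c0 (f (i + 1) : 𝒜) < c0 (X : 𝒜) := by
    intro i hi X hX1 hX2
    obtain ⟨S, hS, hc⟩ := to_sub hX1 hX2
    have := ((hQ (i + 1) hi).2 (by omega)).2.1 S hS
    rw [hc c0 h0] at this
    omega
  refine ⟨hmono, hr0, hd0, ?_, ?_, fun i => (c1 (f (i + 2) : 𝒜) - c1 (f (i + 1) : 𝒜)) /
    ((c0 (f (i + 2) : 𝒜) - c0 (f (i + 1) : 𝒜) : ℤ) : ℝ), ?_⟩
  · have := hQ0.1
    rw [h0.coker, hr0, sub_zero] at this
    exact this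
  · rintro X hX1 hX2 ⟨hX3, hX4⟩
    obtain ⟨S, hS, hc⟩ := to_sub hX1 hX2
    refine hQ0.2 S hS ⟨?_, ?_⟩
    · rw [hc c0 h0, hr0, hX3, sub_zero]
    · rw [hc c1 h1, hd0, hX4, sub_zero]
  · refine ⟨fun i j hij => hmono (by omega), fun i hi => htop _ (by omega), hlt, hpos, ?_, ?_, ?_⟩
    · intro i hi
      exact (div_eq_phi (r := fun X : Subobject E => c0 (X : 𝒜))
        (d := fun X : Subobject E => c1 (X : 𝒜)) (hpos i hi _ (hlt i hi) le_rfl) _).1 rfl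
    · intro i hi X hX1 hX2
      have hp := hpos i hi X hX1 hX2
      refine (div_le_phi (r := fun X : Subobject E => c0 (X : 𝒜)) hp _).1 ?_
      obtain ⟨S, hS, hc⟩ := to_sub hX1 hX2
      have := ((hQ (i + 1) hi).2 (by omega)).2.2 S hS
      rw [hc c0 h0, hc c1 h1, h0.coker, h1.coker, slope_pos (sub_pos.2 hp),
        slope_pos (sub_pos.2 (hpos i hi _ (hlt i hi) le_rfl))] at this
      exact EReal.coe_le_coe_iff.1 this
    · intro i hi
      have := hdec (i + 1) (by omega) (by omega)
      rw [h0.coker, h1.coker, h0.coker, h1.coker,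
        slope_pos (sub_pos.2 (hpos i (by omega) _ (hlt i (by omega)) le_rfl)),
        slope_pos (sub_pos.2 (hpos (i + 1) (by omega) _ (hlt (i + 1) (by omega)) le_rfl))] at this
      exact EReal.coe_lt_coe_iff.1 this

theorem backward {c0 : 𝒜 → ℤ} {c1 : 𝒜 → ℝ} (h0 : Addi c0) (h1 : Addi c1) {E : 𝒜} {m : ℕ}
    {f : ℕ → Subobject E}
    (H : HN (fun X : Subobject E => c0 (X : 𝒜)) (fun X : Subobject E => c1 (X : 𝒜)) m f) :
    IsHNFiltration c0 c1 m f := by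
  obtain ⟨l, C⟩ := H.chain
  have hlt := C.lt
  have hpos := C.pos
  have hsl : ∀ i, i < m → slopeLike (c0 (f (i + 1 + 1) : 𝒜) - c0 (f (i + 1) : 𝒜))
      (c1 (f (i + 1 + 1) : 𝒜) - c1 (f (i + 1) : 𝒜)) = (l i : EReal) := by
    intro i hi
    have hp := hpos i hi _ (hlt i hi) le_rfl
    rw [slope_pos (sub_pos.2 hp), EReal.coe_eq_coe_iff]
    exact (div_eq_phi (r := fun X : Subobject E => c0 (X : 𝒜))
      (d := fun X : Subobject E => c1 (X : 𝒜)) hp _).2 (C.eq i hi)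
  refine ⟨H.mono, ?_, ⟨H.r0, H.d0⟩, ?_, ?_⟩
  · intro i hi
    obtain ⟨j, rfl⟩ : ∃ j, i = j + 1 := ⟨i - 1, by omega⟩
    exact C.top j (by omega)
  · intro i hi
    refine ⟨?_, ?_⟩
    · rintro rfl
      have e0 : c0 (f 0 : 𝒜) = 0 := H.r0
      have e1 : c0 (f (0 + 1) : 𝒜) = 0 := H.r1
      have e2 : c1 (f 0 : 𝒜) = 0 := H.d0
      refine ⟨by rw [h0.coker, e0, e1, sub_zero], ?_⟩
      rintro S hS ⟨hS0, hS1⟩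
      obtain ⟨X, hX1, hX2, hc⟩ := of_sub _ S hS
      rw [hc c0 h0, e0, sub_zero] at hS0
      rw [hc c1 h1, e2, sub_zero] at hS1
      exact H.tf X hX1 hX2 ⟨hS0, hS1⟩
    · intro hi1
      obtain ⟨j, rfl⟩ : ∃ j, i = j + 1 := ⟨i - 1, by omega⟩
      refine ⟨fun hz => (hlt j hi).ne ((isZero_coker _).1 hz), ?_, ?_⟩
      · intro S hS
        obtain ⟨X, hX1, hX2, hc⟩ := of_sub _ S hS
        rw [hc c0 h0]
        exact sub_pos.2 (hpos j hi X hX1 hX2)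
      · intro S hS
        obtain ⟨X, hX1, hX2, hc⟩ := of_sub _ S hS
        have hp := hpos j hi X hX1 hX2
        rw [hc c0 h0, hc c1 h1, h0.coker, h1.coker, hsl j hi, slope_pos (sub_pos.2 hp),
          EReal.coe_le_coe_iff]
        exact (div_le_phi (r := fun X : Subobject E => c0 (X : 𝒜))
          (d := fun X : Subobject E => c1 (X : 𝒜)) hp _).2 (C.le j hi X hX1 hX2)
  · intro i hi1 hi
    obtain ⟨j, rfl⟩ : ∃ j, i = j + 1 := ⟨i - 1, by omega⟩
    rw [h0.coker, h1.coker, h0.coker, h1.coker, hsl j (by omega), hsl (j + 1) (by omega),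
      EReal.coe_lt_coe_iff]
    exact C.anti j (by omega)

end HNBridge

/-- Let `𝒜` be a noetherian abelian category with a slope-like function
`μ` given by additive `C₀ : K(𝒜) → ℤ`, `C₁ : K(𝒜) → ℝ` with `C₀ ≥ 0` on objects and
`C₁(E) ≥ 0` whenever `C₀(E) = 0`.  Then every object `E` of `𝒜` admits a unique
Harder–Narasimhan filtration `E₀₁ ⊆ E₀ ⊆ E₁ ⊆ ⋯ ⊆ E_m = E` with: `E₀₁ ∈ ℬ₀₁`;
`E₀/E₀₁ ∈ ℬ₀` with no nonzero subobject in `ℬ₀₁`; each `E_i/E_{i-1}` (`i ≥ 1`)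
`μ`-semistable with `C₀` positive on all its nonzero subobjects; and
`μ(E₁/E₀) > μ(E₂/E₁) > ⋯ > μ(E_m/E_{m-1})`. -/
theorem harder_narasimhan_filtration_exists_unique
    [Noetherian 𝒜]
    (c0 : 𝒜 → ℤ) (c1 : 𝒜 → ℝ)
    (hc0add : ∀ {A B : 𝒜} (f : A ⟶ B), Mono f → c0 B = c0 A + c0 (cokernel f))
    (hc1add : ∀ {A B : 𝒜} (f : A ⟶ B), Mono f → c1 B = c1 A + c1 (cokernel f))
    (hc0nonneg : ∀ A : 𝒜, 0 ≤ c0 A)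
    (hc1nonneg : ∀ A : 𝒜, c0 A = 0 → 0 ≤ c1 A)
    (E : 𝒜) :
    ∃ (m : ℕ) (filt : ℕ → Subobject E), IsHNFiltration c0 c1 m filt ∧
      ∀ (m' : ℕ) (filt' : ℕ → Subobject E), IsHNFiltration c0 c1 m' filt' →
        m' = m ∧ filt' = filt := by
  have z0 : ∀ {A : 𝒜}, IsZero A → c0 A = 0 := fun hA =>
    HNCat.zero_of_nonneg c0 hc0add (fun A _ => hc0nonneg A) hA
  have h0 : HNCat.Addi c0 := ⟨hc0add, z0⟩
  have h1 : HNCat.Addi c1 := ⟨hc1add, fun hA =>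
    HNCat.zero_of_nonneg c1 hc1add (fun A hA => hc1nonneg A (z0 hA)) hA⟩
  have hbz : IsZero ((⊥ : Subobject E) : 𝒜) :=
    (isZero_zero 𝒜).of_iso Subobject.botCoeIsoZero
  have D : HNLat.Data (Subobject E) (fun X => c0 (X : 𝒜)) (fun X => c1 (X : 𝒜)) := by
    refine ⟨?_, ?_, h0.modular, h1.modular⟩
    · intro a b hab
      have e := h0.coker hab
      have := hc0nonneg (cokernel (Subobject.ofLE a b hab))
      change c0 (a : 𝒜) ≤ c0 (b : 𝒜)
      omega
    · intro a b hab he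
      have e := h0.coker hab
      have e1 := h1.coker hab
      change c0 (a : 𝒜) = c0 (b : 𝒜) at he
      have := hc1nonneg (cokernel (Subobject.ofLE a b hab)) (by omega)
      change c1 (a : 𝒜) ≤ c1 (b : 𝒜)
      linarith
  obtain ⟨m, f, H⟩ := HNLat.HN.exist D (h0.zero hbz) (h1.zero hbz)
  exact ⟨m, f, HNBridge.backward h0 h1 H, fun m' f' H' =>
    H.unique D (h0.zero hbz) (h1.zero hbz) (HNBridge.forward h0 h1 H')⟩
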